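/- Let θ ≥ 0 and let a, b ≥ 0 satisfy ab < 1. Let φ ∈ L^+ with φ ∈ A_a and let f ∈ L^+ with f ∈ A_b. Then the entire function g = φ(Δ_θ)f (whose Taylor coefficient series converge absolutely) belongs to L^+ and to A_c with c = b/(1 − ab). -/

import Mathlib

open Filter Topology
open scoped ENNReal

/-- The norm `‖f‖_b = sup_{k} b^{-k} |f^{(k)}(0)|`, valued in `ℝ≥0∞`. -/
noncomputable def normB (b : ℝ) (f : ℂ → ℂ) : ℝ≥0∞ :=
  ⨆ k : ℕ, ENNReal.ofReal (‖iteratedDeriv k f 0‖ / b ^ k)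

/-- `f ∈ A_a`: `f` is entire and `‖f‖_b < ∞` for every `b > a`. -/
def InA (a : ℝ) (f : ℂ → ℂ) : Prop :=
  Differentiable ℂ f ∧ ∀ b > a, normB b f < ⊤

/-- The Laguerre class `L⁺`: `f(z) = C z^l e^{αz} ∏_{j} (1 + β_j z)` with `α ≥ 0` and
`(β_j)` a nonincreasing summable sequence of nonnegative reals. -/
def LaguerrePlus (f : ℂ → ℂ) : Prop :=
  ∃ (C : ℂ) (l : ℕ) (α : ℝ) (β : ℕ → ℝ),
    0 ≤ α ∧ (∀ j, 0 ≤ β j) ∧ (∀ j, β (j + 1) ≤ β j) ∧ Summable β ∧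
    ∀ z : ℂ, f z = C * z ^ l * Complex.exp ((α : ℂ) * z) * ∏' j : ℕ, (1 + (β j : ℂ) * z)

/-- `q_θ^{(m,k)} = ∏_{l=0}^{k-1} (m-l)(θ+m-1-l)` for `k ≤ m`, and `0` for `k > m`. -/
noncomputable def qTheta (θ : ℝ) (m k : ℕ) : ℝ :=
  if k ≤ m then ∏ l ∈ Finset.range k, ((m - l : ℝ) * (θ + m - 1 - l)) else 0

/-- The `(n,k)`-term of the Taylor coefficient series of `φ(Δ_θ)f`:
`(n!/(k!(n+k)!)) φ^{(k)}(0) f^{(n+k)}(0) q_θ^{(n+k,k)}`. -/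
noncomputable def phiDeltaCoeff (θ : ℝ) (φ f : ℂ → ℂ) (n k : ℕ) : ℂ :=
  ((n.factorial : ℂ) / ((k.factorial : ℂ) * ((n + k).factorial : ℂ))) *
    iteratedDeriv k φ 0 * iteratedDeriv (n + k) f 0 * (qTheta θ (n + k) k : ℂ)

open Polynomial in
/-- real polynomial, real-rooted, with nonnegative coefficients -/
def NP (p : ℝ[X]) : Prop := p.Splits ∧ ∀ n, 0 ≤ p.coeff n

open Polynomial in
lemma NP.eval_pos {p : ℝ[X]} (h : NP p) (h0 : p ≠ 0) {r : ℝ} (hr : 0 < r) : 0 < p.eval r := by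
  rw [Polynomial.eval_eq_sum_range]
  refine Finset.sum_pos' (fun i _ => mul_nonneg (h.2 i) (by positivity)) ⟨p.natDegree, by simp, ?_⟩
  refine mul_pos (lt_of_le_of_ne (h.2 _) ?_) (by positivity)
  exact fun hc => h0 (Polynomial.leadingCoeff_eq_zero.1 hc.symm)

open Polynomial in
lemma NP.root_nonpos {p : ℝ[X]} (h : NP p) {r : ℝ} (hr : r ∈ p.roots) : r ≤ 0 := by
  by_contra! hc
  have h0 : p ≠ 0 := by rintro rfl; simp at hr
  have := h.eval_pos h0 hc
  rw [Polynomial.mem_roots h0] at hr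
  rw [hr] at this
  exact lt_irrefl _ this

lemma multiset_im_sum (s : Multiset ℂ) : s.sum.im = (s.map Complex.im).sum := by
  induction s using Multiset.induction_on with
  | empty => simp
  | cons a s ih => simp [ih]

lemma multiset_sum_neg (s : Multiset ℝ) (hs : s ≠ 0) (h : ∀ x ∈ s, x < 0) : s.sum < 0 := by
  induction s using Multiset.induction_on with
  | empty => simp at hs
  | cons a s ih =>
    rw [Multiset.sum_cons]
    have h1 := h a (by simp)
    by_cases h2 : s = 0
    · subst h2; simpa using h1
    · have := ih h2 (fun x hx => h x (by simp [hx]))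
      linarith

lemma multiset_sum_nonneg (s : Multiset ℝ) (h : ∀ x ∈ s, 0 ≤ x) : 0 ≤ s.sum :=
  Multiset.sum_nonneg h

open Polynomial in
lemma NP.upper {p : ℝ[X]} (h : NP p) (hd : p.natDegree ≠ 0) {z : ℂ} (hz : 0 < z.im) :
    (p.map (algebraMap ℝ ℂ)).eval z ≠ 0 ∧
    ((p.map (algebraMap ℝ ℂ)).derivative.eval z / (p.map (algebraMap ℝ ℂ)).eval z).im < 0 ∧
    0 ≤ (z * ((p.map (algebraMap ℝ ℂ)).derivative.eval z /
      (p.map (algebraMap ℝ ℂ)).eval z)).im := by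
  have h0 : p ≠ 0 := by rintro rfl; simp at hd
  have hP0 : (p.map (algebraMap ℝ ℂ)) ≠ 0 := by
    rwa [Ne, Polynomial.map_eq_zero]
  have hr : (p.map (algebraMap ℝ ℂ)).roots = p.roots.map (algebraMap ℝ ℂ) := h.1.roots_map _
  have hne : (p.map (algebraMap ℝ ℂ)).eval z ≠ 0 := by
    intro hc
    have : z ∈ (p.map (algebraMap ℝ ℂ)).roots := by
      rw [Polynomial.mem_roots hP0]; exact hc
    rw [hr, Multiset.mem_map] at this
    obtain ⟨r, -, rfl⟩ := this
    simp at hz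
  refine ⟨hne, ?_⟩
  rw [(h.1.map _).eval_derivative_div_eval_of_ne_zero hne, hr, Multiset.map_map]
  have hroots : p.roots ≠ 0 := h.1.roots_ne_zero hd
  have key : ∀ r : ℝ, 0 < Complex.normSq (z - r) := by
    intro r
    rw [Complex.normSq_pos]
    intro hc
    have := congrArg Complex.im hc
    simp at this
    exact hz.ne' this
  constructor
  · rw [multiset_im_sum, Multiset.map_map]
    apply multiset_sum_neg
    · simpa using hroots
    · intro x hx
      rw [Multiset.mem_map] at hx
      obtain ⟨r, hr, rfl⟩ := hx
      simp only [Function.comp, Complex.coe_algebraMap, one_div, Complex.inv_im, Complex.sub_im,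
        Complex.ofReal_im, sub_zero]
      exact div_neg_of_neg_of_pos (by linarith) (key r)
  · rw [← Multiset.sum_map_mul_left, multiset_im_sum, Multiset.map_map]
    apply multiset_sum_nonneg
    intro x hx
    rw [Multiset.mem_map] at hx
    obtain ⟨r, hr, rfl⟩ := hx
    have hr0 := h.root_nonpos hr
    simp only [Function.comp, Complex.coe_algebraMap, one_div, Complex.mul_im, Complex.inv_im,
      Complex.inv_re, Complex.sub_im, Complex.sub_re, Complex.ofReal_im, Complex.ofReal_re,
      sub_zero]
    have : z.re * (-z.im / Complex.normSq (z - r)) + z.im * ((z.re - r) / Complex.normSq (z - r))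
      = z.im * (-r) / Complex.normSq (z - r) := by ring
    rw [this]
    exact div_nonneg (mul_nonneg hz.le (by linarith)) (key r).le

open Polynomial in
lemma splits_of_upper {p : ℝ[X]}
    (h : ∀ z : ℂ, 0 < z.im → (p.map (algebraMap ℝ ℂ)).eval z ≠ 0) : p.Splits := by
  refine Splits.of_splits_map (algebraMap ℝ ℂ) (IsAlgClosed.splits _) ?_
  intro a ha
  have hev := (Polynomial.mem_roots'.1 ha).2
  rw [IsRoot.def] at hev
  have hconj : (p.map (algebraMap ℝ ℂ)).eval (starRingEnd ℂ a) = 0 := by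
    have : (p.map (algebraMap ℝ ℂ)).eval (starRingEnd ℂ a)
        = starRingEnd ℂ ((p.map (algebraMap ℝ ℂ)).eval a) := by
      simp only [Polynomial.eval_map_algebraMap]
      rw [Polynomial.aeval_conj]
    rw [this, hev, map_zero]
  rcases lt_trichotomy a.im 0 with h1 | h1 | h1
  · exact absurd hconj (h _ (by simpa using h1))
  · exact ⟨a.re, by apply Complex.ext <;> simp [h1]⟩
  · exact absurd hev (h _ h1)

open Polynomial in
lemma NP.derivative {p : ℝ[X]} (h : NP p) : NP (derivative p) := by
  refine ⟨?_, fun n => ?_⟩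
  · by_cases hd : p.natDegree = 0
    · rw [Polynomial.eq_C_of_natDegree_eq_zero hd]; simp
    · apply splits_of_upper
      intro z hz hc
      have := (h.upper hd hz).2.1
      rw [← Polynomial.derivative_map] at hc
      rw [hc] at this
      simp at this
  · rw [Polynomial.coeff_derivative]
    exact mul_nonneg (h.2 _) (by positivity)

open Polynomial in
/-- the operator `Δ_θ` on polynomials -/
noncomputable def dT (θ : ℝ) : ℝ[X] →ₗ[ℝ] ℝ[X] :=
  θ • Polynomial.derivative + (LinearMap.mulLeft ℝ X) ∘ₗ Polynomial.derivative ∘ₗ Polynomial.derivative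

open Polynomial in
lemma dT_apply (θ : ℝ) (p : ℝ[X]) :
    dT θ p = C θ * derivative p + X * derivative (derivative p) := by
  simp [dT, Polynomial.smul_eq_C_mul]

open Polynomial in
lemma dT_coeff (θ : ℝ) (p : ℝ[X]) (n : ℕ) :
    (dT θ p).coeff n = (n + 1) * (θ + n) * p.coeff (n + 1) := by
  rw [dT_apply]
  cases n with
  | zero => simp [Polynomial.coeff_derivative]
  | succ n => simp [Polynomial.coeff_derivative]; ring

open Polynomial in
lemma NP.step {θ : ℝ} (hθ : 0 ≤ θ) {p : ℝ[X]} (h : NP p) {δ γ : ℝ} (hδ : 0 ≤ δ) (hγ : 0 ≤ γ) :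
    NP (δ • p + γ • dT θ p) := by
  refine ⟨?_, fun n => ?_⟩
  swap
  · simp only [Polynomial.coeff_add, Polynomial.coeff_smul, dT_coeff, smul_eq_mul]
    have := h.2 n
    have := h.2 (n+1)
    positivity
  by_cases hd : p.natDegree = 0
  · rw [dT_apply, Polynomial.eq_C_of_natDegree_eq_zero hd]
    simp only [Polynomial.derivative_C, Polynomial.derivative_zero, mul_zero, add_zero, smul_zero,
      Polynomial.smul_C]
    exact Polynomial.Splits.C _
  by_cases hd2 : (Polynomial.derivative p).natDegree = 0
  · apply Polynomial.Splits.of_natDegree_le_one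
    rw [dT_apply, Polynomial.eq_C_of_natDegree_eq_zero hd2]
    have : p.natDegree ≤ 1 := by
      by_contra! hc
      have := Polynomial.natDegree_derivative p
      omega
    simp only [Polynomial.derivative_C, mul_zero, add_zero, ← Polynomial.C_mul, Polynomial.smul_C]
    compute_degree!
  rcases hγ.eq_or_lt with rfl | hγ
  · simp only [zero_smul, add_zero, Polynomial.smul_eq_C_mul]
    exact (Polynomial.Splits.C _).mul h.1
  apply splits_of_upper
  intro z hz hc
  obtain ⟨h1, h2, h3⟩ := h.upper hd hz
  obtain ⟨h4, h5, -⟩ := h.derivative.upper hd2 hz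
  rw [dT_apply] at hc
  simp only [Polynomial.smul_eq_C_mul, Polynomial.map_add, Polynomial.map_mul, Polynomial.map_C,
    Polynomial.map_X, Polynomial.eval_add, Polynomial.eval_mul, Polynomial.eval_C,
    Polynomial.eval_X, ← Polynomial.derivative_map] at hc
  rw [← Polynomial.derivative_map] at h4 h5
  set f := (p.map (algebraMap ℝ ℂ)).eval z
  set f1 := (Polynomial.derivative (p.map (algebraMap ℝ ℂ))).eval z
  set f2 := (Polynomial.derivative (Polynomial.derivative (p.map (algebraMap ℝ ℂ)))).eval z
  have hz0 : z ≠ 0 := by rintro rfl; simp at hz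
  have e : (δ : ℂ) * (z * (f1 / f))⁻¹ + γ * (θ * z⁻¹ + f2 / f1) = 0 := by
    have : (δ : ℂ) * (z * (f1 / f))⁻¹ + γ * (θ * z⁻¹ + f2 / f1)
      = (δ * f + γ * (θ * f1 + z * f2)) / (z * f1) := by
      field_simp
    rw [this]
    simp only [Complex.coe_algebraMap] at hc
    rw [hc, zero_div]
  have e2 := congrArg Complex.im e
  rw [Complex.add_im, Complex.im_ofReal_mul, Complex.im_ofReal_mul, Complex.add_im,
    Complex.im_ofReal_mul, Complex.inv_im, Complex.inv_im, Complex.zero_im] at e2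
  have i1 : δ * (-(z * (f1 / f)).im / Complex.normSq (z * (f1 / f))) ≤ 0 :=
    mul_nonpos_of_nonneg_of_nonpos hδ
      (div_nonpos_of_nonpos_of_nonneg (by linarith) (Complex.normSq_nonneg _))
  have i2 : θ * (-z.im / Complex.normSq z) ≤ 0 :=
    mul_nonpos_of_nonneg_of_nonpos hθ
      (div_nonpos_of_nonpos_of_nonneg (by linarith) (Complex.normSq_nonneg _))
  have i3 : γ * (θ * (-z.im / Complex.normSq z) + (f2 / f1).im) < 0 :=
    mul_neg_of_pos_of_neg hγ (by linarith)
  linarith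

open Polynomial in
lemma dT_pow_coeff (θ : ℝ) (p : ℝ[X]) (k n : ℕ) :
    ((dT θ ^ k) p).coeff n =
      (∏ i ∈ Finset.range k, (((n:ℝ) + 1 + i) * (θ + n + i))) * p.coeff (n + k) := by
  induction k generalizing n with
  | zero => simp
  | succ k ih =>
    rw [pow_succ', Module.End.mul_apply, dT_coeff, ih, Finset.prod_range_succ']
    push_cast
    have : ∀ i : ℕ, ((n:ℝ) + 1 + 1 + i) * (θ + (n + 1) + i)
      = ((n:ℝ) + 1 + (i + 1)) * (θ + n + (i + 1)) := by intro i; ring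
    simp only [this]
    rw [show n + 1 + k = n + (k + 1) by ring]
    ring

open Polynomial in
/-- polynomials whose operators preserve NP -/
def Good (q : ℝ[X]) : Prop := ∀ θ : ℝ, 0 ≤ θ → ∀ p, NP p → NP (aeval (dT θ) q p)

open Polynomial in
lemma Good.mul {q r : ℝ[X]} (hq : Good q) (hr : Good r) : Good (q * r) := by
  intro θ hθ p hp
  rw [map_mul, Module.End.mul_apply]
  exact hq θ hθ _ (hr θ hθ _ hp)

open Polynomial in
lemma Good.one : Good 1 := by
  intro θ hθ p hp
  simpa using hp

open Polynomial in
lemma Good.lin {δ γ : ℝ} (hδ : 0 ≤ δ) (hγ : 0 ≤ γ) : Good (C δ + C γ * X) := by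
  intro θ hθ p hp
  have := hp.step hθ hδ hγ
  convert this using 1
  simp [Algebra.algebraMap_eq_smul_one]

open Polynomial in
lemma Good.pow {q : ℝ[X]} (hq : Good q) (n : ℕ) : Good (q ^ n) := by
  induction n with
  | zero => simpa using Good.one
  | succ n ih => rw [pow_succ]; exact ih.mul hq

open Polynomial in
lemma Good.prod {q : ℕ → ℝ[X]} (hq : ∀ i, Good (q i)) (n : ℕ) :
    Good (∏ i ∈ Finset.range n, q i) := by
  induction n with
  | zero => simpa using Good.one
  | succ n ih => rw [Finset.prod_range_succ]; exact ih.mul (hq n)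

open Polynomial in
lemma aeval_dT_coeff (θ : ℝ) (q p : ℝ[X]) (n : ℕ) :
    HasSum (fun k => q.coeff k * ((∏ i ∈ Finset.range k, (((n:ℝ) + 1 + i) * (θ + n + i))) *
      p.coeff (n + k))) ((aeval (dT θ) q p).coeff n) := by
  have : (aeval (dT θ) q p).coeff n = ∑ k ∈ Finset.range (q.natDegree + 1),
      q.coeff k * ((∏ i ∈ Finset.range k, (((n:ℝ) + 1 + i) * (θ + n + i))) *
      p.coeff (n + k)) := by
    rw [Polynomial.aeval_eq_sum_range, LinearMap.sum_apply, Polynomial.finsetSum_coeff]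
    simp [dT_pow_coeff]
  rw [this]
  apply hasSum_sum_of_ne_finset_zero
  intro k hk
  rw [Polynomial.coeff_eq_zero_of_natDegree_lt, zero_mul]
  simpa using hk
lemma entire_of_coeffs (c : ℕ → ℂ) (h : ∀ r : ℝ, 0 ≤ r → Summable fun n => ‖c n‖ * r ^ n)
    (g : ℂ → ℂ) (hg : ∀ z, g z = ∑' n, c n * z ^ n) :
    Differentiable ℂ g ∧ ∀ k, iteratedDeriv k g 0 = (k.factorial : ℂ) * c k := by
  have hrad : (FormalMultilinearSeries.ofScalars ℂ c).radius = ⊤ := by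
    apply FormalMultilinearSeries.radius_eq_top_of_summable_norm
    intro r
    simpa [FormalMultilinearSeries.ofScalars_norm] using h r r.2
  have hps : HasFPowerSeriesOnBall g (FormalMultilinearSeries.ofScalars ℂ c) 0 ⊤ := by
    have := (FormalMultilinearSeries.ofScalars ℂ c).hasFPowerSeriesOnBall (by rw [hrad]; simp)
    rw [hrad] at this
    have e : g = (FormalMultilinearSeries.ofScalars ℂ c).sum := by
      funext z
      rw [hg]
      simp [FormalMultilinearSeries.sum, mul_comm]
    rw [e]; exact this
  refine ⟨?_, fun k => ?_⟩
  · have := hps.differentiableOn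
    intro z
    exact (this z (by simp)).differentiableAt (by simp)
  · have := hps.factorial_smul (1:ℂ) k
    rw [iteratedDeriv_eq_iteratedFDeriv, ← this]
    simp

open Polynomial in
lemma hasSum_coeff {K : Type*} [NormedField K] (p : K[X]) (z : K) :
    HasSum (fun k => p.coeff k * z ^ k) (p.eval z) := by
  rw [Polynomial.eval_eq_sum_range]
  apply hasSum_sum_of_ne_finset_zero
  intro k hk
  rw [Polynomial.coeff_eq_zero_of_natDegree_lt, zero_mul]
  simpa using hk

open Polynomial in
lemma hasSum_coeff' (p : ℝ[X]) (z : ℂ) :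
    HasSum (fun k => ((p.coeff k : ℝ) : ℂ) * z ^ k) ((p.map (algebraMap ℝ ℂ)).eval z) := by
  have := hasSum_coeff (p.map (algebraMap ℝ ℂ)) z
  simpa using this

open Polynomial in
lemma mono_limit (P : ℕ → ℝ[X]) (hpos : ∀ N k, 0 ≤ (P N).coeff k)
    (hmono : ∀ N k, (P N).coeff k ≤ (P (N+1)).coeff k) (F : ℂ → ℂ)
    (hF : ∀ z, Tendsto (fun N => ((P N).map (algebraMap ℝ ℂ)).eval z) atTop (𝓝 (F z))) :
    ∃ c : ℕ → ℝ, (∀ N k, (P N).coeff k ≤ c k) ∧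
      (∀ k, Tendsto (fun N => (P N).coeff k) atTop (𝓝 (c k))) ∧
      (∀ r : ℝ, 0 ≤ r → Summable fun k => c k * r ^ k) ∧
      ∀ z, F z = ∑' k, (c k : ℂ) * z ^ k := by
  have hB : ∀ r : ℝ, ∃ B, ∀ N, (P N).eval r ≤ B := by
    intro r
    have h1 := (Complex.continuous_re.tendsto _).comp (hF r)
    obtain ⟨B, hB⟩ := h1.bddAbove_range
    refine ⟨B, fun N => ?_⟩
    have := hB ⟨N, rfl⟩
    simp only [Function.comp] at this
    rw [← Complex.coe_algebraMap, Polynomial.eval_map_apply] at this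
    simpa using this
  have hs : ∀ r : ℝ, 0 ≤ r → ∀ N (s : Finset ℕ), ∑ k ∈ s, (P N).coeff k * r ^ k ≤ (P N).eval r := by
    intro r hr N s
    have := hasSum_coeff (P N) r
    exact sum_le_hasSum s (fun i _ => mul_nonneg (hpos _ _) (by positivity)) this
  have hm : ∀ k, Monotone fun N => (P N).coeff k := fun k => monotone_nat_of_le_succ fun N => hmono N k
  have hbd : ∀ k, BddAbove (Set.range fun N => (P N).coeff k) := by
    intro k
    obtain ⟨B, hB⟩ := hB 1
    refine ⟨B, ?_⟩
    rintro _ ⟨N, rfl⟩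
    have := hs 1 zero_le_one N {k}
    simp at this
    exact this.trans (hB N)
  set c : ℕ → ℝ := fun k => ⨆ N, (P N).coeff k
  have hle : ∀ N k, (P N).coeff k ≤ c k := fun N k => le_ciSup (hbd k) N
  have ht : ∀ k, Tendsto (fun N => (P N).coeff k) atTop (𝓝 (c k)) := fun k =>
    tendsto_atTop_ciSup (hm k) (hbd k)
  have hc0 : ∀ k, 0 ≤ c k := fun k => (hpos 0 k).trans (hle 0 k)
  have hsum : ∀ r : ℝ, 0 ≤ r → Summable fun k => c k * r ^ k := by
    intro r hr
    obtain ⟨B, hB⟩ := hB r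
    apply summable_of_sum_le (c := B) (fun k => mul_nonneg (hc0 k) (by positivity))
    intro s
    have : Tendsto (fun N => ∑ k ∈ s, (P N).coeff k * r ^ k) atTop (𝓝 (∑ k ∈ s, c k * r ^ k)) :=
      tendsto_finsetSum _ fun k _ => (ht k).mul_const _
    exact le_of_tendsto' this fun N => (hs r hr N s).trans (hB N)
  refine ⟨c, hle, ht, hsum, fun z => ?_⟩
  refine tendsto_nhds_unique (hF z) ?_
  have e : (fun N => ((P N).map (algebraMap ℝ ℂ)).eval z)
    = fun N => ∑' k, (((P N).coeff k : ℝ) : ℂ) * z ^ k := by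
    funext N; exact (hasSum_coeff' (P N) z).tsum_eq.symm
  rw [e]
  refine tendsto_tsum_of_dominated_convergence (hsum ‖z‖ (norm_nonneg _)) ?_ ?_
  · intro k
    exact (((Complex.continuous_ofReal.tendsto _).comp (ht k))).mul_const _
  · refine Eventually.of_forall fun N k => ?_
    rw [norm_mul, norm_pow, Complex.norm_real, Real.norm_of_nonneg (hpos N k)]
    exact mul_le_mul_of_nonneg_right (hle N k) (by positivity)

open Polynomial in
lemma coeff_mul_mono {p p' q q' : ℝ[X]} (hp : ∀ k, 0 ≤ p.coeff k) (hq : ∀ k, 0 ≤ q.coeff k)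
    (hpp : ∀ k, p.coeff k ≤ p'.coeff k) (hqq : ∀ k, q.coeff k ≤ q'.coeff k) (k : ℕ) :
    (p * q).coeff k ≤ (p' * q').coeff k := by
  rw [Polynomial.coeff_mul, Polynomial.coeff_mul]
  exact Finset.sum_le_sum fun x _ => mul_le_mul (hpp _) (hqq _) (hq _) ((hp _).trans (hpp _))

open Polynomial in
lemma NP.mul {p q : ℝ[X]} (hp : NP p) (hq : NP q) : NP (p * q) := by
  refine ⟨hp.1.mul hq.1, fun k => ?_⟩
  rw [Polynomial.coeff_mul]
  exact Finset.sum_nonneg fun x _ => mul_nonneg (hp.2 _) (hq.2 _)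

open Polynomial in
lemma NP.one : NP 1 := by
  refine ⟨by simp, fun k => ?_⟩
  rw [Polynomial.coeff_one]; split_ifs <;> norm_num

open Polynomial in
lemma NP.lin {δ γ : ℝ} (hδ : 0 ≤ δ) (hγ : 0 ≤ γ) : NP (C δ + C γ * X) := by
  refine ⟨Polynomial.Splits.of_natDegree_le_one (by compute_degree!), fun k => ?_⟩
  rcases k with _ | _ | k <;> simp [Polynomial.coeff_X, Polynomial.coeff_C, hδ, hγ]

open Polynomial in
lemma NP.pow {q : ℝ[X]} (hq : NP q) (n : ℕ) : NP (q ^ n) := by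
  induction n with
  | zero => simpa using NP.one
  | succ n ih => rw [pow_succ]; exact ih.mul hq

open Polynomial in
lemma NP.prod {q : ℕ → ℝ[X]} (hq : ∀ i, NP (q i)) (n : ℕ) :
    NP (∏ i ∈ Finset.range n, q i) := by
  induction n with
  | zero => simpa using NP.one
  | succ n ih => rw [Finset.prod_range_succ]; exact ih.mul (hq n)

lemma descFactorial_mono_aux (n k : ℕ) :
    n.descFactorial k * (n + 1) ^ k ≤ (n + 1).descFactorial k * n ^ k := by
  induction k with
  | zero => simp
  | succ k ih =>
    rw [Nat.descFactorial_succ, Nat.descFactorial_succ, pow_succ, pow_succ]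
    have h : (n - k) * (n + 1) ≤ (n + 1 - k) * n := by
      rcases Nat.lt_or_ge n k with h | h
      · simp [Nat.sub_eq_zero_of_le h.le]
      · obtain ⟨d, rfl⟩ := Nat.exists_eq_add_of_le h
        rw [show k + d - k = d by omega, show k + d + 1 - k = d + 1 by omega]
        nlinarith
    calc _ = ((n - k) * (n + 1)) * (n.descFactorial k * (n + 1) ^ k) := by ring
      _ ≤ ((n + 1 - k) * n) * ((n + 1).descFactorial k * n ^ k) := Nat.mul_le_mul h ih
      _ = _ := by ring

open Polynomial in
lemma coeff_lin_pow (a : ℝ) (n k : ℕ) :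
    ((C 1 + C a * X : ℝ[X]) ^ n).coeff k = n.choose k * a ^ k := by
  have : (C 1 + C a * X : ℝ[X]) ^ n = ((1 + X) ^ n).comp (C a * X) := by simp
  rw [this, Polynomial.comp_C_mul_X_coeff, Polynomial.coeff_one_add_X_pow]

open Polynomial in
lemma exp_mono {α : ℝ} (hα : 0 ≤ α) (N k : ℕ) :
    ((C 1 + C (α / (N + 1 : ℕ)) * X : ℝ[X]) ^ (N + 1)).coeff k ≤
    ((C 1 + C (α / (N + 1 + 1 : ℕ)) * X : ℝ[X]) ^ (N + 1 + 1)).coeff k := by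
  rw [coeff_lin_pow, coeff_lin_pow]
  have h := descFactorial_mono_aux (N + 1) k
  rw [Nat.descFactorial_eq_factorial_mul_choose, Nat.descFactorial_eq_factorial_mul_choose] at h
  have h2 : (N + 1).choose k * (N + 1 + 1) ^ k ≤ (N + 1 + 1).choose k * (N + 1) ^ k := by
    refine le_of_mul_le_mul_left ?_ k.factorial_pos
    linarith
  have h3 : ((N + 1).choose k : ℝ) * ((N + 1 + 1 : ℕ) : ℝ) ^ k ≤
    ((N + 1 + 1).choose k : ℝ) * ((N + 1 : ℕ) : ℝ) ^ k := by exact_mod_cast h2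
  rw [div_pow, div_pow, mul_div_assoc', mul_div_assoc', div_le_div_iff₀ (by positivity) (by positivity)]
  have : 0 ≤ α ^ k := by positivity
  nlinarith

open Polynomial in
lemma laguerre_approx (Φ : ℂ → ℂ) (h : LaguerrePlus Φ) :
    ∃ (K : ℂ) (P : ℕ → ℝ[X]) (c : ℕ → ℝ), (∀ N, Good (P N)) ∧ (∀ N, NP (P N)) ∧
      (∀ N k, (P N).coeff k ≤ c k) ∧
      (∀ k, Tendsto (fun N => (P N).coeff k) atTop (𝓝 (c k))) ∧
      ∀ k, iteratedDeriv k Φ 0 = K * ((k.factorial : ℂ) * c k) := by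
  obtain ⟨K, l, α, β, hα, hβ, -, hs, hΦ⟩ := h
  set P : ℕ → ℝ[X] := fun N => (C 0 + C 1 * X) ^ l *
    ((C 1 + C (α / (N + 1 : ℕ)) * X) ^ (N + 1) * ∏ j ∈ Finset.range N, (C 1 + C (β j) * X)) with hP
  have hNP : ∀ N, NP (P N) := fun N => ((NP.lin le_rfl zero_le_one).pow l).mul
    (((NP.lin zero_le_one (by positivity)).pow _).mul
      (NP.prod (fun i => NP.lin zero_le_one (hβ i)) N))
  have hG : ∀ N, Good (P N) := fun N => ((Good.lin le_rfl zero_le_one).pow l).mul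
    (((Good.lin zero_le_one (by positivity)).pow _).mul
      (Good.prod (fun i => Good.lin zero_le_one (hβ i)) N))
  have hmono : ∀ N k, (P N).coeff k ≤ (P (N+1)).coeff k := by
    intro N
    have hE : NP ((C 1 + C (α / (N + 1 : ℕ)) * X) ^ (N + 1)) :=
      (NP.lin zero_le_one (by positivity)).pow _
    have hR : NP (∏ j ∈ Finset.range N, (C 1 + C (β j) * X)) :=
      (NP.prod (fun i => NP.lin zero_le_one (hβ i)) N)
    apply coeff_mul_mono ((NP.lin le_rfl zero_le_one).pow l).2 (hE.mul hR).2 (fun k => le_rfl)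
    apply coeff_mul_mono hE.2 hR.2 (exp_mono hα N)
    intro k
    rw [Finset.prod_range_succ, mul_add, Polynomial.coeff_add]
    have : 0 ≤ ((∏ j ∈ Finset.range N, (C 1 + C (β j) * X)) * (C (β N) * X)).coeff k := by
      refine (hR.mul ?_).2 k
      simpa using NP.lin le_rfl (hβ N)
    simpa using this
  obtain ⟨c, h1, h2, h3, h4⟩ := mono_limit P (fun N => (hNP N).2) hmono
    (fun z => z ^ l * (Complex.exp (α * z) * ∏' j, (1 + (β j : ℂ) * z))) (by
      intro z
      have e : (fun N => ((P N).map (algebraMap ℝ ℂ)).eval z) = fun N : ℕ => z ^ l *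
          ((1 + (α * z) / ((N + 1 : ℕ) : ℂ)) ^ (N + 1) *
            ∏ j ∈ Finset.range N, (1 + (β j : ℂ) * z)) := by
        funext N
        simp only [hP, Polynomial.map_mul, Polynomial.map_pow, Polynomial.map_add, Polynomial.map_C,
          Polynomial.map_X, Polynomial.map_prod, Polynomial.eval_mul, Polynomial.eval_pow,
          Polynomial.eval_add, Polynomial.eval_C, Polynomial.eval_X, Polynomial.eval_prod]
        simp
        left; left
        congr 2
        ring
      rw [e]
      refine Tendsto.const_mul _ (Tendsto.mul ?_ ?_)
      · exact (Complex.tendsto_one_add_div_pow_exp (α * z)).comp (tendsto_add_atTop_nat 1)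
      · apply Multipliable.tendsto_prod_tprod_nat
        apply multipliable_one_add_of_summable
        simp only [norm_mul, Complex.norm_real]
        exact hs.norm.mul_right _)
  refine ⟨K, P, c, hG, hNP, h1, h2, ?_⟩
  have hc0 : ∀ k, 0 ≤ c k := fun k => ((hNP 0).2 k).trans (h1 0 k)
  have := (entire_of_coeffs (fun k => K * c k) (by
    intro r hr
    have := (h3 r hr).mul_left ‖K‖
    refine this.congr fun k => ?_
    rw [norm_mul, Complex.norm_real, Real.norm_of_nonneg (hc0 k)]
    ring) Φ (by
    intro z
    rw [hΦ]
    simp only [mul_assoc]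
    rw [tsum_mul_left]
    congr 1
    exact h4 z)).2
  intro k
  rw [this k]; ring

lemma list_prod_range {M : Type*} [CommMonoid M] (F : ℝ → M) (L : List ℝ) :
    (L.map F).prod = ∏ j ∈ Finset.range L.length, F (L.getD j 0) := by
  induction L with
  | nil => simp
  | cons a L ih =>
    rw [List.map_cons, List.prod_cons, List.length_cons, Finset.prod_range_succ', ih]
    simp [mul_comm]

open Polynomial in
lemma NP.rep {p : ℝ[X]} (h : NP p) :
    ∃ (β : ℕ → ℝ) (n : ℕ), Antitone β ∧ (∀ j, 0 ≤ β j) ∧ (∀ j, β j ≤ 1) ∧ (∀ j, n ≤ j → β j = 0) ∧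
      ∀ z : ℂ, (p.map (algebraMap ℝ ℂ)).eval z = (p.map (algebraMap ℝ ℂ)).eval 1 *
        ∏ j ∈ Finset.range n, (1 + (β j : ℂ) * (z - 1)) := by
  set M : Multiset ℝ := p.roots.map (fun r => 1 / (1 - r)) with hM
  set L : List ℝ := M.sort (fun a b => b ≤ a) with hL
  have hLM : (L : Multiset ℝ) = M := Multiset.sort_eq _ _
  have hmem : ∀ x ∈ L, 0 ≤ x ∧ x ≤ 1 := by
    intro x hx
    rw [hL, Multiset.mem_sort, hM, Multiset.mem_map] at hx
    obtain ⟨r, hr, rfl⟩ := hx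
    have := h.root_nonpos hr
    constructor
    · apply div_nonneg zero_le_one; linarith
    · rw [div_le_one] <;> linarith
  have hb : ∀ j, 0 ≤ L.getD j 0 ∧ L.getD j 0 ≤ 1 := by
    intro j
    by_cases hj : j < L.length
    · rw [List.getD_eq_getElem _ _ hj]
      exact hmem _ (List.getElem_mem hj)
    · rw [List.getD_eq_default _ _ (by omega)]; simp
  refine ⟨fun j => L.getD j 0, L.length, ?_, fun j => (hb j).1, fun j => (hb j).2, ?_, ?_⟩
  · intro i j hij
    by_cases hj : j < L.length
    · have hi : i < L.length := by omega
      simp only [List.getD_eq_getElem _ _ hj, List.getD_eq_getElem _ _ hi]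
      rcases hij.eq_or_lt with rfl | hij
      · exact le_rfl
      · exact List.pairwise_iff_getElem.1 (Multiset.pairwise_sort M (fun a b => b ≤ a)) i j hi hj hij
    · simp only
      rw [List.getD_eq_default _ _ (by omega : L.length ≤ j)]
      exact (hb i).1
  · intro j hj
    exact List.getD_eq_default _ _ hj
  · intro z
    rw [← list_prod_range (fun b => (1 + (b : ℂ) * (z - 1))), ← Multiset.prod_coe,
      ← Multiset.map_coe, hLM, hM, Multiset.map_map]
    rw [(h.1.map (algebraMap ℝ ℂ)).eval_eq_prod_roots, (h.1.map (algebraMap ℝ ℂ)).eval_eq_prod_roots,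
      h.1.roots_map, Multiset.map_map, Multiset.map_map, mul_assoc, ← Multiset.prod_map_mul]
    congr 2
    apply Multiset.map_congr rfl
    intro r hr
    have hr0 := h.root_nonpos hr
    have : (1 - (r:ℂ)) ≠ 0 := by
      have : (1 - r) ≠ 0 := by linarith
      exact_mod_cast this
    simp only [Function.comp, Complex.coe_algebraMap]
    push_cast
    field_simp
    ring

lemma one_add_sum_le (β : ℕ → ℝ) (h : ∀ j, 0 ≤ β j) (n : ℕ) :
    1 + ∑ j ∈ Finset.range n, β j ≤ ∏ j ∈ Finset.range n, (1 + β j) := by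
  induction n with
  | zero => simp
  | succ n ih =>
    rw [Finset.sum_range_succ, Finset.prod_range_succ]
    have h1 : 0 ≤ ∑ j ∈ Finset.range n, β j := Finset.sum_nonneg fun j _ => h j
    nlinarith [h n]

lemma E_bound (u : ℂ) (R : ℝ) (hu : ‖u‖ ≤ R) :
    ‖(1 + u) * Complex.exp (-u) - 1‖ ≤ ((1 + R) * Real.exp R + 1) * ‖u‖ ^ 2 := by
  have h := Complex.norm_exp_sub_sum_le_norm_mul_exp (-u) 2
  simp [Finset.sum_range_succ] at h
  have e : (1 + u) * Complex.exp (-u) - 1 = (1 + u) * (Complex.exp (-u) - (1 + -u)) - u ^ 2 := by ring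
  rw [e]
  refine (norm_sub_le _ _).trans ?_
  rw [norm_mul, norm_pow]
  have h1 : ‖1 + u‖ ≤ 1 + R := by
    refine (norm_add_le _ _).trans ?_
    simpa using hu
  have h2 : Real.exp ‖u‖ ≤ Real.exp R := Real.exp_le_exp.2 hu
  have h3 : ‖Complex.exp (-u) - (1 + -u)‖ ≤ ‖u‖ ^ 2 * Real.exp R :=
    h.trans (mul_le_mul_of_nonneg_left h2 (by positivity))
  have h4 := mul_le_mul h1 h3 (norm_nonneg _) ((norm_nonneg _).trans h1)
  linarith

lemma laguerre_of_shift (g : ℂ → ℂ) (K : ℂ) (α : ℝ) (β : ℕ → ℝ) (hα : 0 ≤ α) (hanti : Antitone β)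
    (h0 : ∀ j, 0 ≤ β j) (h1 : ∀ j, β j ≤ 1) (hs : Summable β)
    (hg : ∀ z, g z = K * Complex.exp (α * (z - 1)) * ∏' j, (1 + (β j : ℂ) * (z - 1))) :
    LaguerrePlus g := by
  classical
  have hex : ∃ l, β l < 1 := by
    have := hs.tendsto_atTop_zero
    exact (this.eventually (gt_mem_nhds zero_lt_one)).exists
  set l := Nat.find hex with hl
  have hl1 : β l < 1 := Nat.find_spec hex
  have hl2 : ∀ j < l, β j = 1 := fun j hj => le_antisymm (h1 j) (not_lt.1 (Nat.find_min hex hj))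
  have hlt : ∀ j, β (j + l) ≤ β l := fun j => hanti (by omega)
  have hpos : ∀ j, 0 < 1 - β (j + l) := fun j => by have := hlt j; linarith
  have hs' : Summable fun j => β (j + l) := (summable_nat_add_iff l).2 hs
  have hγ : Summable fun j => β (j + l) / (1 - β (j + l)) := by
    refine Summable.of_nonneg_of_le (fun j => div_nonneg (h0 _) (hpos j).le) (fun j => ?_)
      (hs'.mul_right (1 - β l)⁻¹)
    rw [div_eq_mul_inv]
    refine mul_le_mul_of_nonneg_left ?_ (h0 _)
    apply inv_anti₀
    · linarith
    · have := hlt j; linarith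
  refine ⟨K * Complex.exp (-α) * ∏' j, (1 + (-(β (j + l) : ℂ))), l, α,
    fun j => β (j + l) / (1 - β (j + l)), hα, fun j => div_nonneg (h0 _) (hpos j).le, ?_, hγ, ?_⟩
  · intro j
    have hj : β (j + 1 + l) ≤ β (j + l) := hanti (by omega)
    apply div_le_div₀ (h0 _) hj (hpos j)
    linarith
  · intro z
    have m1 : Multipliable fun j => (1 + (-(β (j + l) : ℂ))) := by
      apply multipliable_one_add_of_summable
      simpa using hs'.norm
    have m2 : Multipliable fun j => (1 + ((β (j + l) / (1 - β (j + l)) : ℝ) : ℂ) * z) := by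
      apply multipliable_one_add_of_summable
      simp only [norm_mul, Complex.norm_real]
      exact hγ.norm.mul_right _
    have e1 : ∀ j, (1 + (-(β (j + l) : ℂ))) * (1 + ((β (j + l) / (1 - β (j + l)) : ℝ) : ℂ) * z)
        = 1 + (β (j + l) : ℂ) * (z - 1) := by
      intro j
      have : (1 - (β (j + l) : ℂ)) ≠ 0 := by exact_mod_cast (hpos j).ne'
      push_cast
      field_simp
      ring
    have e2 := m1.tprod_mul m2
    simp only [e1] at e2
    have m3 : Multipliable fun j => (1 + (β (j + l) : ℂ) * (z - 1)) := by
      simpa only [e1] using m1.mul m2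
    have e3 := Multipliable.prod_mul_tprod_nat_mul' (f := fun j => (1 + (β j : ℂ) * (z - 1))) (k := l) m3
    have e4 : ∏ j ∈ Finset.range l, (1 + (β j : ℂ) * (z - 1)) = z ^ l := by
      rw [Finset.prod_congr rfl (g := fun _ => z)]
      · simp
      · intro j hj
        rw [hl2 j (by simpa using hj)]
        push_cast; ring
    rw [hg, ← e3, e4, e2, show (α : ℂ) * (z - 1) = -α + α * z by ring, Complex.exp_add]
    ring

open Polynomial in
lemma closure_laguerre (p : ℕ → ℝ[X]) (hp : ∀ N, NP (p N)) (g : ℂ → ℂ) (hg1 : g 1 ≠ 0)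
    (hg : ∀ z, Tendsto (fun N => ((p N).map (algebraMap ℝ ℂ)).eval z) atTop (𝓝 (g z))) :
    LaguerrePlus g := by
  choose β n hanti h0 h1 hz hrep using fun N => (hp N).rep
  set S : ℕ → ℝ := fun N => ∑ j ∈ Finset.range (n N), β N j with hS
  have hsum : ∀ N, HasSum (β N) (S N) := fun N =>
    hasSum_sum_of_ne_finset_zero fun j hj => hz N j (by simpa using hj)
  have hS0 : ∀ N, 0 ≤ S N := fun N => Finset.sum_nonneg fun j _ => h0 N j
  -- bound on S
  obtain ⟨B, hB⟩ : ∃ B, ∀ᶠ N in atTop, S N ≤ B := by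
    have ht : Tendsto (fun N => ‖((p N).map (algebraMap ℝ ℂ)).eval 2 /
        ((p N).map (algebraMap ℝ ℂ)).eval 1‖) atTop (𝓝 ‖g 2 / g 1‖) :=
      ((hg 2).div (hg 1) hg1).norm
    refine ⟨‖g 2 / g 1‖ + 1, ?_⟩
    filter_upwards [ht.eventually (gt_mem_nhds (lt_add_one _)), (hg 1).eventually_ne hg1]
      with N hN hN1
    rw [hrep N 2, mul_div_cancel_left₀ _ hN1] at hN
    have := one_add_sum_le (β N) (h0 N) (n N)
    have e : ∏ j ∈ Finset.range (n N), (1 + (β N j : ℂ) * (2 - 1))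
      = ((∏ j ∈ Finset.range (n N), (1 + β N j) : ℝ) : ℂ) := by
      push_cast
      apply Finset.prod_congr rfl
      intro j _
      ring
    rw [e, Complex.norm_real] at hN
    have h3 := le_abs_self (∏ j ∈ Finset.range (n N), (1 + β N j))
    rw [Real.norm_eq_abs] at hN
    simp only [hS]
    linarith
  -- compactness
  have hcomp : IsCompact ((Set.univ.pi fun _ : ℕ => Set.Icc (0:ℝ) 1) ×ˢ Set.Icc (0:ℝ) B) :=
    (isCompact_univ_pi fun _ => isCompact_Icc).prod isCompact_Icc
  obtain ⟨⟨b, s⟩, -, ψ, hψ, hlim⟩ := hcomp.tendsto_subseq' (x := fun N => (β N, S N)) (by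
    apply Eventually.frequently
    filter_upwards [hB] with N hN
    exact ⟨fun j _ => ⟨h0 N j, h1 N j⟩, hS0 N, hN⟩)
  have hψt := hψ.tendsto_atTop
  have hb : ∀ j, Tendsto (fun N => β (ψ N) j) atTop (𝓝 (b j)) := by
    intro j
    have := ((continuous_apply j).comp continuous_fst).tendsto (b, s) |>.comp hlim
    exact this
  have hs : Tendsto (fun N => S (ψ N)) atTop (𝓝 s) :=
    (continuous_snd.tendsto (b, s)).comp hlim
  have hb0 : ∀ j, 0 ≤ b j := fun j => ge_of_tendsto' (hb j) fun N => h0 _ _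
  have hb1 : ∀ j, b j ≤ 1 := fun j => le_of_tendsto' (hb j) fun N => h1 _ _
  have hbanti : Antitone b := fun i j hij =>
    le_of_tendsto_of_tendsto' (hb j) (hb i) fun N => hanti _ hij
  have hfin : ∀ t : Finset ℕ, ∑ j ∈ t, b j ≤ s := by
    intro t
    refine le_of_tendsto_of_tendsto' (tendsto_finsetSum t fun j _ => hb j) hs fun N => ?_
    exact sum_le_hasSum t (fun j _ => h0 _ j) (hsum _)
  have hbs : Summable b := summable_of_sum_le hb0 hfin
  have hbS : ∑' j, b j ≤ s := hbs.tsum_le_of_sum_le hfin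
  refine laguerre_of_shift g (g 1) (s - ∑' j, b j) b (by linarith) hbanti hb0 hb1 hbs ?_
  intro z
  set w := z - 1 with hw
  have hB0 : 0 ≤ B := by
    obtain ⟨N, hN⟩ := hB.exists
    exact (hS0 N).trans hN
  -- the convergence of the canonical products
  have hT : Tendsto (fun N => ∏' j, (1 + ((1 + (β (ψ N) j : ℂ) * w) *
      Complex.exp (-((β (ψ N) j : ℂ) * w)) - 1))) atTop
      (𝓝 (∏' j, (1 + ((1 + (b j : ℂ) * w) * Complex.exp (-((b j : ℂ) * w)) - 1)))) := by
    refine tendsto_tprod_one_add_of_dominated_convergence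
      (bound := fun j : ℕ => ((1 + B * ‖w‖) * Real.exp (B * ‖w‖) + 1) *
        ((B * ‖w‖) ^ 2 * (1 / ((j + 1 : ℕ) : ℝ) ^ 2))) ?_ ?_ ?_
    · apply Summable.mul_left
      apply Summable.mul_left
      exact (summable_nat_add_iff 1).2 (Real.summable_one_div_nat_pow.2 one_lt_two)
    · intro j
      have hc : Continuous fun x : ℝ => (1 + (x : ℂ) * w) * Complex.exp (-((x : ℂ) * w)) - 1 := by
        fun_prop
      exact (hc.tendsto _).comp (hb j)
    · filter_upwards [hψt.eventually hB] with N hN j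
      have hj : ((j + 1 : ℕ) : ℝ) * β (ψ N) j ≤ B := by
        have a1 : ∑ i ∈ Finset.range (j + 1), β (ψ N) i ≤ S (ψ N) :=
          sum_le_hasSum _ (fun i _ => h0 _ i) (hsum _)
        have a2 : ∑ i ∈ Finset.range (j + 1), β (ψ N) j ≤ ∑ i ∈ Finset.range (j + 1), β (ψ N) i :=
          Finset.sum_le_sum fun i hi => hanti _ (by simp at hi; omega)
        rw [Finset.sum_const, Finset.card_range, nsmul_eq_mul] at a2
        linarith
      have hj' : β (ψ N) j ≤ B / ((j + 1 : ℕ) : ℝ) := by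
        rw [le_div_iff₀ (by positivity)]; linarith
      have hu : ‖(β (ψ N) j : ℂ) * w‖ ≤ B / ((j + 1 : ℕ) : ℝ) * ‖w‖ := by
        rw [norm_mul, Complex.norm_real, Real.norm_of_nonneg (h0 _ _)]
        exact mul_le_mul_of_nonneg_right hj' (norm_nonneg _)
      have hu2 : B / ((j + 1 : ℕ) : ℝ) * ‖w‖ ≤ B * ‖w‖ := by
        apply mul_le_mul_of_nonneg_right _ (norm_nonneg _)
        apply div_le_self hB0
        push_cast
        have : (0:ℝ) ≤ j := by positivity
        linarith
      refine (E_bound _ (B * ‖w‖) (hu.trans hu2)).trans ?_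
      apply mul_le_mul_of_nonneg_left _ (by positivity)
      calc ‖(β (ψ N) j : ℂ) * w‖ ^ 2 ≤ (B / ((j + 1 : ℕ) : ℝ) * ‖w‖) ^ 2 := by gcongr
        _ = _ := by ring
  simp only [add_sub_cancel] at hT
  have hprod : ∀ N, ∏ j ∈ Finset.range (n N), (1 + (β N j : ℂ) * w) =
      (∏' j, (1 + (β N j : ℂ) * w) * Complex.exp (-((β N j : ℂ) * w))) *
        Complex.exp ((S N : ℂ) * w) := by
    intro N
    rw [tprod_eq_prod (s := Finset.range (n N))]
    · rw [Finset.prod_mul_distrib, ← Complex.exp_sum, mul_assoc, ← Complex.exp_add]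
      have : ∑ i ∈ Finset.range (n N), -((β N i : ℂ) * w) + (S N : ℂ) * w = 0 := by
        simp only [hS]
        push_cast
        rw [Finset.sum_neg_distrib, Finset.sum_mul]
        ring
      rw [this, Complex.exp_zero, mul_one]
    · intro j hj
      rw [hz N j (by simpa using hj)]
      simp
  have hlimz : Tendsto (fun N => ((p (ψ N)).map (algebraMap ℝ ℂ)).eval z) atTop
      (𝓝 (g 1 * ((∏' j, (1 + (b j : ℂ) * w) * Complex.exp (-((b j : ℂ) * w))) *
        Complex.exp ((s : ℂ) * w)))) := by
    have e : (fun N => ((p (ψ N)).map (algebraMap ℝ ℂ)).eval z) = fun N =>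
      ((p (ψ N)).map (algebraMap ℝ ℂ)).eval 1 *
      ((∏' j, (1 + (β (ψ N) j : ℂ) * w) * Complex.exp (-((β (ψ N) j : ℂ) * w))) *
        Complex.exp ((S (ψ N) : ℂ) * w)) := by
      funext N
      rw [hrep (ψ N) z, ← hprod]
    rw [e]
    refine ((hg 1).comp hψt).mul (hT.mul ?_)
    have hc : Continuous fun x : ℝ => Complex.exp ((x : ℂ) * w) := by fun_prop
    exact (hc.tendsto _).comp hs
  rw [tendsto_nhds_unique ((hg z).comp hψt) hlimz]
  have m1 : Multipliable fun j => (1 + (b j : ℂ) * w) := by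
    apply multipliable_one_add_of_summable
    simp only [norm_mul, Complex.norm_real]
    exact hbs.norm.mul_right _
  have hexp : HasProd (fun j => Complex.exp (-((b j : ℂ) * w)))
      (Complex.exp (-(((∑' j, b j : ℝ) : ℂ) * w))) := by
    have : HasSum (fun j => -((b j : ℂ) * w)) (-(((∑' j, b j : ℝ) : ℂ) * w)) := by
      apply HasSum.neg
      apply HasSum.mul_right
      exact_mod_cast hbs.hasSum
    exact this.cexp
  rw [m1.tprod_mul hexp.multipliable, hexp.tprod_eq]
  have : Complex.exp (((s - ∑' j, b j : ℝ) : ℂ) * w) =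
    Complex.exp (-(((∑' j, b j : ℝ) : ℂ) * w)) * Complex.exp ((s : ℂ) * w) := by
    rw [← Complex.exp_add]
    congr 1
    push_cast
    ring
  rw [this]
  ring

lemma normB_bound {b : ℝ} (hb : 0 < b) {f : ℂ → ℂ} (h : normB b f < ⊤) :
    ∃ M : ℝ, 0 ≤ M ∧ ∀ k, ‖iteratedDeriv k f 0‖ ≤ M * b ^ k := by
  refine ⟨(normB b f).toReal, ENNReal.toReal_nonneg, fun k => ?_⟩
  have h1 : ENNReal.ofReal (‖iteratedDeriv k f 0‖ / b ^ k) ≤ normB b f :=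
    le_iSup (fun k : ℕ => ENNReal.ofReal (‖iteratedDeriv k f 0‖ / b ^ k)) k
  have h2 := (ENNReal.ofReal_le_iff_le_toReal h.ne).1 h1
  rwa [div_le_iff₀ (by positivity)] at h2

lemma normB_lt_top {b : ℝ} (hb : 0 < b) {f : ℂ → ℂ} (M : ℝ)
    (h : ∀ k, ‖iteratedDeriv k f 0‖ ≤ M * b ^ k) : normB b f < ⊤ := by
  refine lt_of_le_of_lt (b := ENNReal.ofReal M) (iSup_le fun k => ?_) ENNReal.ofReal_lt_top
  apply ENNReal.ofReal_le_ofReal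
  rw [div_le_iff₀ (by positivity)]
  exact h k

lemma LaguerrePlus.const_mul {g : ℂ → ℂ} (h : LaguerrePlus g) (K : ℂ) :
    LaguerrePlus fun z => K * g z := by
  obtain ⟨C, l, α, β, h1, h2, h3, h4, h5⟩ := h
  exact ⟨K * C, l, α, β, h1, h2, h3, h4, fun z => by simp only [h5 z]; ring⟩

lemma LaguerrePlus.zero : LaguerrePlus fun _ => 0 :=
  ⟨0, 0, 0, fun _ => 0, le_rfl, fun _ => le_rfl, fun _ => le_rfl, summable_zero, fun z => by simp⟩

/-- The weight in the polynomial formula. -/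
noncomputable def wT (θ : ℝ) (n k : ℕ) : ℝ :=
  ∏ i ∈ Finset.range k, (((n:ℝ) + 1 + i) * (θ + n + i))

lemma wT_nonneg {θ : ℝ} (hθ : 0 ≤ θ) (n k : ℕ) : 0 ≤ wT θ n k :=
  Finset.prod_nonneg fun i _ => by positivity

lemma qTheta_eq (θ : ℝ) (n k : ℕ) : qTheta θ (n + k) k = wT θ n k := by
  rw [qTheta, if_pos (by omega), wT, ← Finset.prod_range_reflect]
  apply Finset.prod_congr rfl
  intro i hi
  have hi : i < k := by simpa using hi
  obtain ⟨d, rfl⟩ : ∃ d, k = i + 1 + d := Nat.exists_eq_add_of_le hi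
  rw [show i + 1 + d - 1 - i = d by omega]
  push_cast
  ring

lemma wT_bound {θ : ℝ} (hθ : 0 ≤ θ) {m : ℕ} (hm : θ ≤ m) (n k : ℕ) :
    (n.factorial : ℝ) * wT θ n k ≤
      ((n + k).factorial : ℝ) * ((k.factorial : ℝ) * ((k + (m + n)).choose (m + n) : ℝ)) := by
  rw [wT, Finset.prod_mul_distrib, ← mul_assoc]
  have e1 : (n.factorial : ℝ) * ∏ i ∈ Finset.range k, ((n:ℝ) + 1 + i) = (n + k).factorial := by
    rw [← Nat.factorial_mul_ascFactorial, Nat.ascFactorial_eq_prod_range]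
    push_cast
    rfl
  rw [e1]
  apply mul_le_mul_of_nonneg_left _ (by positivity)
  have e2 : (k.factorial : ℝ) * ((k + (m + n)).choose (m + n) : ℝ)
      = ∏ i ∈ Finset.range k, (((m + n + 1 + i : ℕ)) : ℝ) := by
    rw [← Nat.choose_symm_add (a := k) (b := m + n), add_comm k, ← Nat.cast_mul, ← Nat.ascFactorial_eq_factorial_mul_choose,
      Nat.ascFactorial_eq_prod_range, Nat.cast_prod]
  rw [e2]
  apply Finset.prod_le_prod
  · intro i _; positivity
  · intro i _; push_cast; linarith

lemma term_bound {θ : ℝ} (hθ : 0 ≤ θ) {m : ℕ} (hm : θ ≤ m) {c d : ℕ → ℝ}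
    (hc : ∀ k, 0 ≤ c k) (hd : ∀ k, 0 ≤ d k) {a b M₁ M₂ : ℝ} (ha : 0 < a) (hb : 0 < b)
    (hM₁ : ∀ k, (k.factorial : ℝ) * c k ≤ M₁ * a ^ k)
    (hM₂ : ∀ k, (k.factorial : ℝ) * d k ≤ M₂ * b ^ k) (n k : ℕ) :
    (n.factorial : ℝ) * (c k * (wT θ n k * d (n + k))) ≤
      M₁ * M₂ * b ^ n * (((k + (m + n)).choose (m + n) : ℝ) * (a * b) ^ k) := by
  have h1 := wT_bound hθ hm n k
  have hcd : 0 ≤ c k * d (n + k) := mul_nonneg (hc _) (hd _)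
  have hM : 0 ≤ M₁ * a ^ k := le_trans (mul_nonneg (by positivity) (hc k)) (hM₁ k)
  calc (n.factorial : ℝ) * (c k * (wT θ n k * d (n + k)))
      = (n.factorial : ℝ) * wT θ n k * (c k * d (n + k)) := by ring
    _ ≤ ((n + k).factorial : ℝ) * ((k.factorial : ℝ) * ((k + (m + n)).choose (m + n) : ℝ)) *
        (c k * d (n + k)) := mul_le_mul_of_nonneg_right h1 hcd
    _ = (((k.factorial : ℝ) * c k) * (((n + k).factorial : ℝ) * d (n + k))) *
        ((k + (m + n)).choose (m + n) : ℝ) := by ring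
    _ ≤ ((M₁ * a ^ k) * (M₂ * b ^ (n + k))) * ((k + (m + n)).choose (m + n) : ℝ) := by
        apply mul_le_mul_of_nonneg_right _ (by positivity)
        exact mul_le_mul (hM₁ k) (hM₂ _) (mul_nonneg (by positivity) (hd _)) hM
    _ = _ := by rw [pow_add, mul_pow]; ring

lemma sum_bound {θ : ℝ} (hθ : 0 ≤ θ) {c d : ℕ → ℝ}
    (hc : ∀ k, 0 ≤ c k) (hd : ∀ k, 0 ≤ d k) {a b M₁ M₂ : ℝ} (ha : 0 < a) (hb : 0 < b)
    (hab : a * b < 1)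
    (hM₁ : ∀ k, (k.factorial : ℝ) * c k ≤ M₁ * a ^ k)
    (hM₂ : ∀ k, (k.factorial : ℝ) * d k ≤ M₂ * b ^ k) :
    (∀ n, Summable fun k => c k * (wT θ n k * d (n + k))) ∧
    ∃ M : ℝ, ∀ n, (n.factorial : ℝ) * ∑' k, c k * (wT θ n k * d (n + k)) ≤
      M * (b / (1 - a * b)) ^ n := by
  obtain ⟨m, hm⟩ := exists_nat_ge θ
  have hn : ‖a * b‖ < 1 := by rw [Real.norm_of_nonneg (by positivity)]; exact hab
  have hG : ∀ n, HasSum (fun k => M₁ * M₂ * b ^ n *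
      (((k + (m + n)).choose (m + n) : ℝ) * (a * b) ^ k))
      (M₁ * M₂ * b ^ n * (1 / (1 - a * b) ^ (m + n + 1))) := fun n =>
    (hasSum_choose_mul_geometric_of_norm_lt_one (m + n) hn).mul_left _
  have hb1 := term_bound hθ hm hc hd ha hb hM₁ hM₂
  have hs : ∀ n, Summable fun k => (n.factorial : ℝ) * (c k * (wT θ n k * d (n + k))) := fun n =>
    Summable.of_nonneg_of_le (fun k => mul_nonneg (by positivity)
      (mul_nonneg (hc _) (mul_nonneg (wT_nonneg hθ _ _) (hd _)))) (hb1 n) (hG n).summable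
  refine ⟨fun n => (summable_mul_left_iff (by positivity)).1 (hs n),
    M₁ * M₂ / (1 - a * b) ^ (m + 1), fun n => ?_⟩
  rw [← tsum_mul_left]
  refine ((hs n).tsum_le_tsum (hb1 n) (hG n).summable).trans ?_
  rw [(hG n).tsum_eq]
  apply le_of_eq
  have : (1 - a * b) ≠ 0 := by linarith
  rw [div_pow]
  field_simp
  ring

lemma exists_eps {a b c : ℝ} (hab : a * b < 1) (hc : b / (1 - a * b) < c) :
    ∃ ε > 0, (a + ε) * (b + ε) < 1 ∧ (b + ε) / (1 - (a + ε) * (b + ε)) < c := by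
  have h1 : Tendsto (fun ε : ℝ => (a + ε) * (b + ε)) (𝓝[>] 0) (𝓝 (a * b)) := by
    have : Continuous fun ε : ℝ => (a + ε) * (b + ε) := by fun_prop
    have := this.tendsto 0
    simp only [add_zero] at this
    exact this.mono_left nhdsWithin_le_nhds
  have h2 : Tendsto (fun ε : ℝ => b + ε) (𝓝[>] 0) (𝓝 b) := by
    have : Continuous fun ε : ℝ => (b + ε) := by fun_prop
    have := this.tendsto 0
    simp only [add_zero] at this
    exact this.mono_left nhdsWithin_le_nhds
  have h3 := h2.div (h1.const_sub 1) (by linarith : (1 - a * b) ≠ 0)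
  have := (h1.eventually (gt_mem_nhds hab)).and ((h3.eventually (gt_mem_nhds hc)).and self_mem_nhdsWithin)
  obtain ⟨ε, e1, e2, e3⟩ := this.exists
  exact ⟨ε, e3, e1, e2⟩

lemma scaled_bound {φ : ℂ → ℂ} {K : ℂ} (hK : K ≠ 0) {c : ℕ → ℝ} (hc : ∀ k, 0 ≤ c k)
    (h : ∀ k, iteratedDeriv k φ 0 = K * ((k.factorial : ℂ) * c k)) {a : ℝ} (ha : 0 < a)
    (hn : normB a φ < ⊤) : ∃ M : ℝ, ∀ k, (k.factorial : ℝ) * c k ≤ M * a ^ k := by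
  obtain ⟨M, -, hM⟩ := normB_bound ha hn
  refine ⟨M / ‖K‖, fun k => ?_⟩
  have h1 := hM k
  rw [h, norm_mul, norm_mul, Complex.norm_natCast, Complex.norm_real,
    Real.norm_of_nonneg (hc k)] at h1
  have : 0 < ‖K‖ := norm_pos_iff.2 hK
  rw [div_mul_eq_mul_div, le_div_iff₀ this]
  linarith

theorem stmt_11 (θ a b : ℝ) (hθ : 0 ≤ θ) (ha : 0 ≤ a) (hb : 0 ≤ b) (hab : a * b < 1)
    (φ f : ℂ → ℂ) (hφL : LaguerrePlus φ) (hφa : InA a φ)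
    (hfL : LaguerrePlus f) (hfb : InA b f) :
    (∀ n : ℕ, Summable fun k : ℕ => ‖phiDeltaCoeff θ φ f n k‖) ∧
    ∃ g : ℂ → ℂ,
      (∀ z : ℂ, g z =
        ∑' n : ℕ, (∑' k : ℕ, phiDeltaCoeff θ φ f n k) * z ^ n / (n.factorial : ℂ)) ∧
      LaguerrePlus g ∧ InA (b / (1 - a * b)) g := by
  classical
  obtain ⟨K₁, P, c, hPG, hPN, hPc, hPt, hφ⟩ := laguerre_approx φ hφL
  obtain ⟨K₂, Q, d, -, hQN, hQd, hQt, hf⟩ := laguerre_approx f hfL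
  have hc : ∀ k, 0 ≤ c k := fun k => ((hPN 0).2 k).trans (hPc 0 k)
  have hd : ∀ k, 0 ≤ d k := fun k => ((hQN 0).2 k).trans (hQd 0 k)
  have hterm : ∀ n k, phiDeltaCoeff θ φ f n k =
      K₁ * K₂ * (n.factorial : ℂ) * ((c k * (wT θ n k * d (n + k)) : ℝ) : ℂ) := by
    intro n k
    rw [phiDeltaCoeff, hφ, hf, qTheta_eq]
    have h1 : (k.factorial : ℂ) ≠ 0 := by exact_mod_cast k.factorial_ne_zero
    have h2 : ((n + k).factorial : ℂ) ≠ 0 := by exact_mod_cast (n + k).factorial_ne_zero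
    push_cast
    field_simp
  by_cases hK : K₁ * K₂ = 0
  · have h0 : ∀ n k, phiDeltaCoeff θ φ f n k = 0 := fun n k => by rw [hterm, hK]; ring
    refine ⟨fun n => by simp [h0, summable_zero], fun _ => 0, fun z => by simp [h0],
      LaguerrePlus.zero, differentiable_const _, fun x hx => ?_⟩
    have hx0 : 0 < x := lt_of_le_of_lt (div_nonneg hb (by linarith)) hx
    refine normB_lt_top hx0 0 fun k => ?_
    simp [iteratedDeriv_const]
  have hK1 : K₁ ≠ 0 := left_ne_zero_of_mul hK
  have hK2 : K₂ ≠ 0 := right_ne_zero_of_mul hK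
  -- quantitative bounds
  have hmain : ∀ x > b / (1 - a * b),
      (∀ n, Summable fun k => c k * (wT θ n k * d (n + k))) ∧
      ∃ M : ℝ, ∀ n, (n.factorial : ℝ) * ∑' k, c k * (wT θ n k * d (n + k)) ≤ M * x ^ n := by
    intro x hx
    obtain ⟨ε, hε, h1, h2⟩ := exists_eps hab hx
    obtain ⟨M₁, hM₁⟩ := scaled_bound hK1 hc hφ (by linarith) (hφa.2 (a + ε) (by linarith))
    obtain ⟨M₂, hM₂⟩ := scaled_bound hK2 hd hf (by linarith) (hfb.2 (b + ε) (by linarith))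
    obtain ⟨h3, M, h4⟩ := sum_bound hθ hc hd (by linarith) (by linarith) h1 hM₁ hM₂
    have hq : 0 ≤ (b + ε) / (1 - (a + ε) * (b + ε)) := div_nonneg (by linarith) (by linarith)
    have hM : 0 ≤ M := by
      have := h4 0
      simp only [pow_zero, mul_one] at this
      exact le_trans (mul_nonneg (by positivity) (tsum_nonneg fun k =>
        mul_nonneg (hc _) (mul_nonneg (wT_nonneg hθ _ _) (hd _)))) this
    exact ⟨h3, M, fun n => (h4 n).trans
      (mul_le_mul_of_nonneg_left (pow_le_pow_left₀ hq h2.le n) hM)⟩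
  have hcpos : 0 ≤ b / (1 - a * b) := div_nonneg hb (by linarith)
  obtain ⟨hsum, M, hM⟩ := hmain (b / (1 - a * b) + 1) (by linarith)
  set x₀ := b / (1 - a * b) + 1 with hx₀
  set G : ℕ → ℝ := fun n => ∑' k, c k * (wT θ n k * d (n + k)) with hG
  have hG0 : ∀ n, 0 ≤ G n := fun n => tsum_nonneg fun k =>
    mul_nonneg (hc _) (mul_nonneg (wT_nonneg hθ _ _) (hd _))
  have hcoef : ∀ n, ∑' k, phiDeltaCoeff θ φ f n k = K₁ * K₂ * (n.factorial : ℂ) * (G n : ℂ) := by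
    intro n
    simp only [hterm, hG]
    rw [tsum_mul_left, Complex.ofReal_tsum]
  have hGs : ∀ r : ℝ, 0 ≤ r → Summable fun n => G n * r ^ n := by
    intro r hr
    have := (Real.summable_pow_div_factorial (x₀ * r)).mul_left M
    refine Summable.of_nonneg_of_le (fun n => mul_nonneg (hG0 n) (by positivity)) (fun n => ?_) this
    have h1 := hM n
    have h2 : (0:ℝ) < n.factorial := by positivity
    rw [mul_div_assoc', le_div_iff₀ h2, mul_pow]
    have h3 : 0 ≤ r ^ n := by positivity
    have := mul_le_mul_of_nonneg_right h1 h3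
    nlinarith
  -- the approximating polynomials
  set R : ℕ → Polynomial ℝ := fun N => Polynomial.aeval (dT θ) (P N) (Q N) with hR
  have hRN : ∀ N, NP (R N) := fun N => hPG N θ hθ _ (hQN N)
  have hRs : ∀ N n, HasSum (fun k => (P N).coeff k * (wT θ n k * (Q N).coeff (n + k)))
      ((R N).coeff n) := fun N n => aeval_dT_coeff θ (P N) (Q N) n
  have hRle : ∀ N n k, (P N).coeff k * (wT θ n k * (Q N).coeff (n + k)) ≤
      c k * (wT θ n k * d (n + k)) := fun N n k =>
    mul_le_mul (hPc N k) (mul_le_mul_of_nonneg_left (hQd N _) (wT_nonneg hθ _ _))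
      (mul_nonneg (wT_nonneg hθ _ _) ((hQN N).2 _)) (hc k)
  have hRG : ∀ N n, (R N).coeff n ≤ G n := fun N n =>
    hasSum_le (hRle N n) (hRs N n) (hsum n).hasSum
  have hRt : ∀ n, Tendsto (fun N => (R N).coeff n) atTop (𝓝 (G n)) := by
    intro n
    have e : (fun N => (R N).coeff n) = fun N =>
        ∑' k, (P N).coeff k * (wT θ n k * (Q N).coeff (n + k)) := by
      funext N; exact (hRs N n).tsum_eq.symm
    rw [e]
    refine tendsto_tsum_of_dominated_convergence (hsum n) (fun k => ?_)
      (Eventually.of_forall fun N k => ?_)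
    · exact (hPt k).mul ((hQt (n + k)).const_mul _)
    · rw [Real.norm_of_nonneg (mul_nonneg ((hPN N).2 _)
        (mul_nonneg (wT_nonneg hθ _ _) ((hQN N).2 _)))]
      exact hRle N n k
  have hRz : ∀ z : ℂ, Tendsto (fun N => ((R N).map (algebraMap ℝ ℂ)).eval z) atTop
      (𝓝 (∑' n, (G n : ℂ) * z ^ n)) := by
    intro z
    have e : (fun N => ((R N).map (algebraMap ℝ ℂ)).eval z)
      = fun N => ∑' k, (((R N).coeff k : ℝ) : ℂ) * z ^ k := by
      funext N; exact (hasSum_coeff' (R N) z).tsum_eq.symm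
    rw [e]
    refine tendsto_tsum_of_dominated_convergence (hGs ‖z‖ (norm_nonneg _)) ?_ ?_
    · intro k
      exact (((Complex.continuous_ofReal.tendsto _).comp (hRt k))).mul_const _
    · refine Eventually.of_forall fun N k => ?_
      rw [norm_mul, norm_pow, Complex.norm_real, Real.norm_of_nonneg ((hRN N).2 k)]
      exact mul_le_mul_of_nonneg_right (hRG N k) (by positivity)
  have hLag : LaguerrePlus fun z => ∑' n, (G n : ℂ) * z ^ n := by
    by_cases hz : ∀ n, G n = 0
    · simpa [hz] using LaguerrePlus.zero
    · push Not at hz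
      obtain ⟨n, hn⟩ := hz
      refine closure_laguerre R hRN _ ?_ hRz
      have h1 : ∑' n, (G n : ℂ) * 1 ^ n = ((∑' n, G n : ℝ) : ℂ) := by
        rw [Complex.ofReal_tsum]; simp
      have h2 : Summable G := by simpa using hGs 1 zero_le_one
      have h3 : 0 < ∑' n, G n := h2.tsum_pos hG0 n (lt_of_le_of_ne (hG0 n) hn.symm)
      simp only [h1]
      exact_mod_cast h3.ne'
  have hgeq : ∀ z : ℂ, K₁ * K₂ * ∑' n, (G n : ℂ) * z ^ n =
      ∑' n : ℕ, (∑' k : ℕ, phiDeltaCoeff θ φ f n k) * z ^ n / (n.factorial : ℂ) := by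
    intro z
    rw [← tsum_mul_left]
    congr 1
    funext n
    rw [hcoef]
    have h1 : (n.factorial : ℂ) ≠ 0 := by exact_mod_cast n.factorial_ne_zero
    field_simp
  obtain ⟨hdiff, hder⟩ := entire_of_coeffs (fun n => K₁ * K₂ * G n) (by
    intro r hr
    refine ((hGs r hr).mul_left ‖K₁ * K₂‖).congr fun n => ?_
    rw [norm_mul _ ((G n : ℝ) : ℂ), Complex.norm_real, Real.norm_of_nonneg (hG0 n)]
    ring) (fun z => K₁ * K₂ * ∑' n, (G n : ℂ) * z ^ n) (by
    intro z
    rw [← tsum_mul_left]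
    simp only [mul_assoc])
  refine ⟨fun n => ?_, fun z => K₁ * K₂ * ∑' n, (G n : ℂ) * z ^ n, hgeq, hLag.const_mul _,
    hdiff, fun x hx => ?_⟩
  · refine ((hsum n).mul_left ‖K₁ * K₂ * (n.factorial : ℂ)‖).congr fun k => ?_
    rw [hterm, norm_mul _ (((_ : ℝ) : ℂ)), Complex.norm_real, Real.norm_of_nonneg
      (mul_nonneg (hc _) (mul_nonneg (wT_nonneg hθ _ _) (hd _)))]
  · obtain ⟨-, M', hM'⟩ := hmain x hx
    refine normB_lt_top (lt_of_le_of_lt hcpos hx) (‖K₁ * K₂‖ * M') fun k => ?_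
    rw [hder, norm_mul, norm_mul (K₁ * K₂), Complex.norm_natCast, Complex.norm_real,
      Real.norm_of_nonneg (hG0 k)]
    have := mul_le_mul_of_nonneg_left (hM' k) (norm_nonneg (K₁ * K₂))
    linarith
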